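/- Let A = a₀ + 𝐚 + 𝒜 + a₁₂₃I be a multivector in Cl(0,3) with a₊ > 0 and a₋ > 0. For any integers c₁₊ and c₁₋, define A₀₊ = (1/2)·log((a₀ + a₁₂₃)² + a₊²), A₀₋ = (1/2)·log((a₀ - a₁₂₃)² + a₋²), A₁₂₊ = ((atan2(a₊, a₀ + a₁₂₃) + 2πc₁₊)/a₊)·(1 + I)·(𝐚 + 𝒜), A₁₂₋ = ((atan2(a₋, a₀ - a₁₂₃) + 2πc₁₋)/a₋)·(1 - I)·(𝐚 + 𝒜), and L = (1/2)·(A₀₊ + A₀₋ + A₁₂₊ + A₁₂₋ + (A₀₊ - A₀₋)·I). Then exp L = A. -/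

import Mathlib

open Real CliffordAlgebra

noncomputable section

/-- The quadratic form of signature (0,3): `Q(x) = -(x₁² + x₂² + x₃²)`. -/
def Q03 : QuadraticForm ℝ (Fin 3 → ℝ) := QuadraticMap.weightedSumSquares ℝ ![-1, -1, -1]

/-- The real Clifford algebra Cl(0,3). -/
abbrev Cl03 := CliffordAlgebra Q03

/-- The canonical (module) topology on Cl(0,3), i.e. the unique Hausdorff topology making it a
topological real vector space (it is finite-dimensional). -/
instance : TopologicalSpace Cl03 := moduleTopology ℝ Cl03

/-- The orthonormal generators `e₁, e₂, e₃` (indexed here by `0, 1, 2`). -/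
def e (i : Fin 3) : Cl03 := ι Q03 (Pi.single i 1)

/-- The pseudoscalar `I = e₁e₂e₃`. -/
def I3 : Cl03 := e 0 * e 1 * e 2

/-- The exponential `exp M = ∑ₖ Mᵏ/k!` in Cl(0,3). -/
def expCl (M : Cl03) : Cl03 := ∑' n : ℕ, (n.factorial : ℝ)⁻¹ • M ^ n

/-- `atan2 y x` is the argument in `(-π, π]` of the complex number `x + iy`. -/
def atan2 (y x : ℝ) : ℝ := Complex.arg ⟨x, y⟩

/-- Powers of an element split along two complementary orthogonal idempotents. -/
theorem add_mul_pow_of_orthogonal_idempotents {R : Type*} [Ring R] {p q x y : R}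
    (hp : p * p = p) (hq : q * q = q) (hpq : p * q = 0) (hqp : q * p = 0) (h1 : p + q = 1)
    (hx : Commute p x) (hy : Commute q y) (n : ℕ) :
    (p * x + q * y) ^ n = p * x ^ n + q * y ^ n := by
  induction n with
  | zero => simp [h1]
  | succ n ih =>
    have hxn : x ^ n * p = p * x ^ n := (hx.pow_right n).eq.symm
    have hyn : y ^ n * q = q * y ^ n := (hy.pow_right n).eq.symm
    have h₁ : p * x ^ n * (p * x) = p * x ^ (n + 1) := by
      rw [mul_assoc, ← mul_assoc (x ^ n), hxn, ← mul_assoc, ← mul_assoc, hp, mul_assoc, pow_succ]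
    have h₂ : q * y ^ n * (q * y) = q * y ^ (n + 1) := by
      rw [mul_assoc, ← mul_assoc (y ^ n), hyn, ← mul_assoc, ← mul_assoc, hq, mul_assoc, pow_succ]
    have h₃ : p * x ^ n * (q * y) = 0 := by
      rw [← hxn, mul_assoc, ← mul_assoc p, hpq, zero_mul, mul_zero]
    have h₄ : q * y ^ n * (p * x) = 0 := by
      rw [← hyn, mul_assoc, ← mul_assoc q, hqp, zero_mul, mul_zero]
    rw [pow_succ, ih, add_mul, mul_add, mul_add, h₁, h₂, h₃, h₄, add_zero, zero_add]

/-- A real vector space with its module topology is Hausdorff, since linear functionals separate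
its points. -/
theorem t2Space_of_isModuleTopology_real (V : Type*) [AddCommGroup V] [Module ℝ V]
    [TopologicalSpace V] [IsModuleTopology ℝ V] : T2Space V := by
  refine T2Space.of_injective_continuous (Y := Module.Dual ℝ V → ℝ) (f := fun v φ => φ v) ?_ ?_
  · intro v w h
    rw [← sub_eq_zero, ← Module.forall_dual_apply_eq_zero_iff ℝ]
    intro φ
    rw [map_sub, sub_eq_zero]
    exact congrFun h φ
  · exact continuous_pi fun φ => IsModuleTopology.continuous_of_linearMap φ

instance : IsModuleTopology ℝ Cl03 := ⟨rfl⟩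

theorem Q03_apply (v : Fin 3 → ℝ) : Q03 v = -(v 0 ^ 2 + v 1 ^ 2 + v 2 ^ 2) := by
  simp [Q03, QuadraticMap.weightedSumSquares_apply, Fin.sum_univ_three]
  ring

theorem e_mul_self (i : Fin 3) : e i * e i = -1 := by
  rw [e, ι_sq_scalar, Q03_apply]
  fin_cases i <;> simp

theorem e_mul_e_of_ne {i j : Fin 3} (h : i ≠ j) : e i * e j = -(e j * e i) := by
  rw [eq_neg_iff_add_eq_zero, e, e, ι_mul_ι_add_swap, QuadraticMap.polar]
  simp only [Q03_apply]
  fin_cases i <;> fin_cases j <;> simp_all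

theorem ι_eq_sum_e (b : Fin 3 → ℝ) : ι Q03 b = b 0 • e 0 + b 1 • e 1 + b 2 • e 2 := by
  simp only [e, ← map_smul, ← map_add]
  congr 1
  ext i
  fin_cases i <;> simp

theorem e_one_mul_e_zero : e 1 * e 0 = -(e 0 * e 1) := e_mul_e_of_ne (by decide)

theorem e_two_mul_e_zero : e 2 * e 0 = -(e 0 * e 2) := e_mul_e_of_ne (by decide)

theorem e_two_mul_e_one : e 2 * e 1 = -(e 1 * e 2) := e_mul_e_of_ne (by decide)

theorem e_mul_self_mul (i : Fin 3) (x : Cl03) : e i * (e i * x) = -x := by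
  rw [← mul_assoc, e_mul_self, neg_one_mul]

theorem e_one_mul_e_zero_mul (x : Cl03) : e 1 * (e 0 * x) = -(e 0 * (e 1 * x)) := by
  rw [← mul_assoc, e_one_mul_e_zero, neg_mul, mul_assoc]

theorem e_two_mul_e_zero_mul (x : Cl03) : e 2 * (e 0 * x) = -(e 0 * (e 2 * x)) := by
  rw [← mul_assoc, e_two_mul_e_zero, neg_mul, mul_assoc]

theorem e_two_mul_e_one_mul (x : Cl03) : e 2 * (e 1 * x) = -(e 1 * (e 2 * x)) := by
  rw [← mul_assoc, e_two_mul_e_one, neg_mul, mul_assoc]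

theorem I3_mul_self : I3 * I3 = 1 := by
  simp [I3, mul_assoc, e_mul_self, e_one_mul_e_zero_mul, e_two_mul_e_zero_mul, e_two_mul_e_one_mul]

theorem I3_mul_e_zero : I3 * e 0 = -(e 1 * e 2) := by
  simp [I3, mul_assoc, e_mul_self_mul, e_two_mul_e_zero, e_one_mul_e_zero_mul]

theorem I3_mul_e_one : I3 * e 1 = e 0 * e 2 := by
  simp [I3, mul_assoc, e_mul_self_mul, e_two_mul_e_one]

theorem I3_mul_e_two : I3 * e 2 = -(e 0 * e 1) := by
  simp [I3, mul_assoc, e_mul_self]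

theorem I3_commute_e (i : Fin 3) : Commute I3 (e i) := by
  fin_cases i <;>
  simp [Commute, SemiconjBy, I3, mul_assoc, e_mul_self, e_mul_self_mul, e_two_mul_e_zero,
    e_two_mul_e_one, e_one_mul_e_zero_mul, e_two_mul_e_zero_mul,
    e_two_mul_e_one_mul]

theorem I3_commute_ι (b : Fin 3 → ℝ) : Commute I3 (ι Q03 b) := by
  rw [ι_eq_sum_e]
  exact (((I3_commute_e 0).smul_right _).add_right ((I3_commute_e 1).smul_right _)).add_right
    ((I3_commute_e 2).smul_right _)

/-- A vector plus a bivector is a combination of two vectors over the centre `ℝ ⊕ ℝ I3`. -/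
theorem vector_add_bivector_eq (a1 a2 a3 a12 a13 a23 : ℝ) :
    (a1 • e 0 + a2 • e 1 + a3 • e 2) +
      (a12 • (e 0 * e 1) + a13 • (e 0 * e 2) + a23 • (e 1 * e 2)) =
    ι Q03 ![a1, a2, a3] + I3 * ι Q03 ![-a23, a13, -a12] := by
  simp only [ι_eq_sum_e, mul_add, mul_smul_comm, I3_mul_e_zero, I3_mul_e_one, I3_mul_e_two]
  simp
  abel

/-- `log |z| + i (arg z + 2πc)` exponentiates to `z`, in coordinates. -/
theorem exp_log_atan2 (x y : ℝ) (hy : 0 < y) (c : ℤ) :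
    Complex.exp ⟨1 / 2 * Real.log (x ^ 2 + y ^ 2), atan2 y x + 2 * π * c⟩ = ⟨x, y⟩ := by
  have hz : (⟨x, y⟩ : ℂ) ≠ 0 := fun h => hy.ne' (congrArg Complex.im h)
  have hlog : 1 / 2 * Real.log (x ^ 2 + y ^ 2) = Real.log ‖(⟨x, y⟩ : ℂ)‖ := by
    rw [Complex.norm_def, Real.log_sqrt (Complex.normSq_nonneg _), Complex.normSq_mk]
    ring_nf
  have h : (⟨1 / 2 * Real.log (x ^ 2 + y ^ 2), atan2 y x + 2 * π * c⟩ : ℂ) =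
      Complex.log ⟨x, y⟩ + c * (2 * π * Complex.I) := by
    apply Complex.ext
    · simp [Complex.log_re, ← hlog]
    · simp [Complex.log_im, atan2]
      ring
  rw [h, Complex.exp_add, Complex.exp_log hz, Complex.exp_int_mul_two_pi_mul_I, mul_one]

theorem half_one_add_I3_mul_self :
    ((1 / 2 : ℝ) • (1 + I3)) * ((1 / 2 : ℝ) • (1 + I3)) = (1 / 2 : ℝ) • (1 + I3) := by
  simp only [smul_mul_smul_comm, mul_add, add_mul, one_mul, mul_one, I3_mul_self]
  module

theorem half_one_sub_I3_mul_self :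
    ((1 / 2 : ℝ) • (1 - I3)) * ((1 / 2 : ℝ) • (1 - I3)) = (1 / 2 : ℝ) • (1 - I3) := by
  simp only [smul_mul_smul_comm, mul_sub, sub_mul, one_mul, mul_one, I3_mul_self]
  module

/-- The exponential on the image of `ℂ × ℂ` in `Cl(0,3)` given by square roots `u`, `w` of `-1`
commuting with the pseudoscalar. -/
theorem expCl_half_add_half (u w : Cl03) (hu : u * u = -1) (hw : w * w = -1)
    (hIu : Commute I3 u) (hIw : Commute I3 w) (z z' : ℂ) :
    expCl ((1 / 2 : ℝ) • (1 + I3) * Complex.lift ⟨u, hu⟩ z +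
        (1 / 2 : ℝ) • (1 - I3) * Complex.lift ⟨w, hw⟩ z') =
      (1 / 2 : ℝ) • (1 + I3) * Complex.lift ⟨u, hu⟩ (Complex.exp z) +
        (1 / 2 : ℝ) • (1 - I3) * Complex.lift ⟨w, hw⟩ (Complex.exp z') := by
  have hlift (v : Cl03) (hv : v * v = -1) (hIv : Commute I3 v) (z : ℂ) :
      Commute I3 (Complex.lift ⟨v, hv⟩ z) := by
    rw [Complex.lift_apply, Complex.liftAux_apply]
    exact (Algebra.commute_algebraMap_right _ _).add_right (hIv.smul_right _)
  have := t2Space_of_isModuleTopology_real Cl03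
  have := IsModuleTopology.toContinuousAdd ℝ Cl03
  have := IsModuleTopology.toContinuousSMul ℝ Cl03
  have := IsModuleTopology.topologicalAddGroup ℝ Cl03
  have hsum (p v : Cl03) (hv : v * v = -1) (z : ℂ) :
      HasSum (fun n : ℕ => p * Complex.lift ⟨v, hv⟩ ((n.factorial : ℝ)⁻¹ • z ^ n))
        (p * Complex.lift ⟨v, hv⟩ (Complex.exp z)) := by
    have h := NormedSpace.exp_series_hasSum_exp' (𝕂 := ℝ) z
    rw [← Complex.exp_eq_exp_ℂ] at h
    let φ : ℂ →ₗ[ℝ] Cl03 := LinearMap.mulLeft ℝ p ∘ₗ (Complex.lift ⟨v, hv⟩).toLinearMap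
    exact h.map φ φ.continuous_of_finiteDimensional
  refine HasSum.tsum_eq ?_
  refine ((hsum _ u hu z).add (hsum _ w hw z')).congr_fun fun n => ?_
  rw [add_mul_pow_of_orthogonal_idempotents half_one_add_I3_mul_self half_one_sub_I3_mul_self
    _ _ _ (((Commute.one_left _).add_left (hlift u hu hIu z)).smul_left _)
    (((Commute.one_left _).sub_left (hlift w hw hIw z')).smul_left _)]
  · simp only [map_smul, map_pow, mul_smul_comm, smul_add]
  · simp only [smul_mul_smul_comm, mul_sub, add_mul, one_mul, mul_one, I3_mul_self]
    module
  · simp only [smul_mul_smul_comm, mul_add, sub_mul, one_mul, mul_one, I3_mul_self]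
    module
  · module

theorem inv_smul_ι_mul_self {b : Fin 3 → ℝ} {r : ℝ} (hr : 0 < r)
    (h : r = √(b 2 ^ 2 + b 1 ^ 2 + b 0 ^ 2)) :
    (r⁻¹ • ι Q03 b) * (r⁻¹ • ι Q03 b) = -1 := by
  have h2 : r ^ 2 = b 2 ^ 2 + b 1 ^ 2 + b 0 ^ 2 := by rw [h, Real.sq_sqrt (by positivity)]
  have hQ : Q03 b = -r ^ 2 := by rw [Q03_apply, h2]; ring
  rw [smul_mul_smul_comm, ι_sq_scalar, hQ, Algebra.algebraMap_eq_smul_one, smul_smul]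
  have h3 : r⁻¹ * r⁻¹ * -r ^ 2 = -1 := by field_simp
  rw [h3, neg_one_smul]

/-- the generic logarithm formula in Cl(0,3) exponentiates back to `A`. -/
theorem exp_genericLog_Cl03
    (a0 a1 a2 a3 a12 a13 a23 a123 ap am : ℝ) (c1p c1m : ℤ)
    (va bA A A0p A0m A12p A12m L : Cl03)
    (hva : va = a1 • e 0 + a2 • e 1 + a3 • e 2)
    (hbA : bA = a12 • (e 0 * e 1) + a13 • (e 0 * e 2) + a23 • (e 1 * e 2))
    (hA : A = algebraMap ℝ Cl03 a0 + va + bA + a123 • I3)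
    (hap : ap = Real.sqrt ((a3 - a12) ^ 2 + (a2 + a13) ^ 2 + (a1 - a23) ^ 2))
    (ham : am = Real.sqrt ((a3 + a12) ^ 2 + (a2 - a13) ^ 2 + (a1 + a23) ^ 2))
    (happos : 0 < ap) (hampos : 0 < am)
    (hA0p : A0p = algebraMap ℝ Cl03 ((1 / 2) * Real.log ((a0 + a123) ^ 2 + ap ^ 2)))
    (hA0m : A0m = algebraMap ℝ Cl03 ((1 / 2) * Real.log ((a0 - a123) ^ 2 + am ^ 2)))
    (hA12p : A12p = ((atan2 ap (a0 + a123) + 2 * π * c1p) / ap) • ((1 + I3) * (va + bA)))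
    (hA12m : A12m = ((atan2 am (a0 - a123) + 2 * π * c1m) / am) • ((1 - I3) * (va + bA)))
    (hL : L = (1 / 2 : ℝ) • (A0p + A0m + A12p + A12m + (A0p - A0m) * I3)) :
    expCl L = A := by
  set x : Fin 3 → ℝ := ![a1, a2, a3] with hx
  set y : Fin 3 → ℝ := ![-a23, a13, -a12] with hy
  have hB : va + bA = ι Q03 x + I3 * ι Q03 y := by
    rw [hva, hbA, vector_add_bivector_eq]
  have hBp : (1 + I3) * (va + bA) = (1 + I3) * ι Q03 (x + y) := by
    have h : (1 + I3) * I3 = 1 + I3 := by rw [add_mul, I3_mul_self, one_mul, add_comm]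
    rw [hB, mul_add, ← mul_assoc, h, map_add, mul_add]
  have hBm : (1 - I3) * (va + bA) = (1 - I3) * ι Q03 (x - y) := by
    have h : (1 - I3) * I3 = -(1 - I3) := by rw [sub_mul, I3_mul_self, one_mul, neg_sub]
    rw [hB, mul_add, ← mul_assoc, h, map_sub, mul_sub, neg_mul, ← sub_eq_add_neg]
  have hu := inv_smul_ι_mul_self (b := x + y) happos (by rw [hap]; simp [hx, hy]; ring_nf)
  have hw := inv_smul_ι_mul_self (b := x - y) hampos (by rw [ham]; simp [hx, hy])
  have key := expCl_half_add_half _ _ hu hw ((I3_commute_ι _).smul_right _)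
    ((I3_commute_ι _).smul_right _)
    ⟨1 / 2 * Real.log ((a0 + a123) ^ 2 + ap ^ 2), atan2 ap (a0 + a123) + 2 * π * c1p⟩
    ⟨1 / 2 * Real.log ((a0 - a123) ^ 2 + am ^ 2), atan2 am (a0 - a123) + 2 * π * c1m⟩
  rw [exp_log_atan2 _ _ happos, exp_log_atan2 _ _ hampos] at key
  simp only [Complex.lift_apply, Complex.liftAux_apply, Algebra.algebraMap_eq_smul_one, smul_smul,
    mul_add, smul_mul_assoc, mul_smul_comm, mul_one, ← hBp, ← hBm, mul_inv_cancel₀ happos.ne',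
    mul_inv_cancel₀ hampos.ne'] at key
  convert key using 1
  · rw [hL, hA0p, hA0m, hA12p, hA12m]
    congr 1
    simp only [Algebra.algebraMap_eq_smul_one, add_mul, sub_mul, mul_add,
      smul_mul_assoc, one_mul, div_eq_mul_inv]
    module
  · rw [hA]
    simp only [Algebra.algebraMap_eq_smul_one, add_mul, sub_mul, one_mul]
    module
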